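/- Let T be a strict t-norm on [0,1]. Then T is power stable: for all u, v ∈ [0,1] and every real t > 0, (T(u,v))_T^(t) = T(u_T^(t), v_T^(t)). -/

import Mathlib

open Set

/-- A t-norm on `[0,1]`: commutative, associative, nondecreasing in each argument,
with neutral element `1`. -/
structure IsTnorm (T : ℝ → ℝ → ℝ) : Prop where
  maps_to : ∀ x ∈ Icc (0:ℝ) 1, ∀ y ∈ Icc (0:ℝ) 1, T x y ∈ Icc (0:ℝ) 1
  comm : ∀ x ∈ Icc (0:ℝ) 1, ∀ y ∈ Icc (0:ℝ) 1, T x y = T y x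
  assoc : ∀ x ∈ Icc (0:ℝ) 1, ∀ y ∈ Icc (0:ℝ) 1, ∀ z ∈ Icc (0:ℝ) 1,
    T (T x y) z = T x (T y z)
  mono : ∀ x ∈ Icc (0:ℝ) 1, ∀ y ∈ Icc (0:ℝ) 1, ∀ z ∈ Icc (0:ℝ) 1,
    y ≤ z → T x y ≤ T x z
  one : ∀ x ∈ Icc (0:ℝ) 1, T x 1 = x

/-- A t-conorm on `[0,1]`: commutative, associative, nondecreasing in each argument,
with neutral element `0`. -/
structure IsTconorm (S : ℝ → ℝ → ℝ) : Prop where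
  maps_to : ∀ x ∈ Icc (0:ℝ) 1, ∀ y ∈ Icc (0:ℝ) 1, S x y ∈ Icc (0:ℝ) 1
  comm : ∀ x ∈ Icc (0:ℝ) 1, ∀ y ∈ Icc (0:ℝ) 1, S x y = S y x
  assoc : ∀ x ∈ Icc (0:ℝ) 1, ∀ y ∈ Icc (0:ℝ) 1, ∀ z ∈ Icc (0:ℝ) 1,
    S (S x y) z = S x (S y z)
  mono : ∀ x ∈ Icc (0:ℝ) 1, ∀ y ∈ Icc (0:ℝ) 1, ∀ z ∈ Icc (0:ℝ) 1,
    y ≤ z → S x y ≤ S x z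
  zero : ∀ x ∈ Icc (0:ℝ) 1, S x 0 = x

/-- Continuity of a binary operation on the unit square. -/
def ContinuousOn2 (T : ℝ → ℝ → ℝ) : Prop :=
  ContinuousOn (fun p : ℝ × ℝ => T p.1 p.2) (Icc (0:ℝ) 1 ×ˢ Icc (0:ℝ) 1)

/-- `n`-fold power `u_T^(n)` with respect to a t-norm: `u_T^(0) = 1`,
`u_T^(n+1) = T (u_T^(n)) u`. -/
def Tpow (T : ℝ → ℝ → ℝ) (u : ℝ) : ℕ → ℝ
  | 0 => 1
  | n + 1 => T (Tpow T u n) u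

/-- `n`-fold power `u_S^(n)` with respect to a t-conorm: `u_S^(0) = 0`,
`u_S^(n+1) = S (u_S^(n)) u`. -/
def Spow (S : ℝ → ℝ → ℝ) (u : ℝ) : ℕ → ℝ
  | 0 => 0
  | n + 1 => S (Spow S u n) u

/-- `p`-th root `u_T^(1/p) = sup {v ∈ [0,1] | v_T^(p) < u}`. -/
noncomputable def Troot (T : ℝ → ℝ → ℝ) (u : ℝ) (p : ℕ) : ℝ :=
  sSup {v ∈ Icc (0:ℝ) 1 | Tpow T v p < u}

/-- `p`-th root `u_S^(1/p) = inf {v ∈ [0,1] | v_S^(p) > u}`. -/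
noncomputable def Sroot (S : ℝ → ℝ → ℝ) (u : ℝ) (p : ℕ) : ℝ :=
  sInf {v ∈ Icc (0:ℝ) 1 | u < Spow S v p}

/-- Rational power `u_T^(q/p) = (u_T^(1/p))_T^(q)`, with `r = q/p` in lowest terms. -/
noncomputable def TratPow (T : ℝ → ℝ → ℝ) (u : ℝ) (r : ℚ) : ℝ :=
  Tpow T (Troot T u r.den) r.num.toNat

/-- Rational power `u_S^(q/p) = (u_S^(1/p))_S^(q)`, with `r = q/p` in lowest terms. -/
noncomputable def SratPow (S : ℝ → ℝ → ℝ) (u : ℝ) (r : ℚ) : ℝ :=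
  Spow S (Sroot S u r.den) r.num.toNat

/-- Real power `u_T^(t) = inf {u_T^(r) | r ∈ [0,t] ∩ ℚ}`. -/
noncomputable def TrePow (T : ℝ → ℝ → ℝ) (u : ℝ) (t : ℝ) : ℝ :=
  sInf (TratPow T u '' {r : ℚ | 0 ≤ r ∧ (r : ℝ) ≤ t})

/-- Real power `u_S^(t) = sup {u_S^(r) | r ∈ [0,t] ∩ ℚ}`. -/
noncomputable def SrePow (S : ℝ → ℝ → ℝ) (u : ℝ) (t : ℝ) : ℝ :=
  sSup (SratPow S u '' {r : ℚ | 0 ≤ r ∧ (r : ℝ) ≤ t})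

/-- A t-norm is Archimedean if for all `x, y ∈ (0,1)` there is `n` with `x_T^(n) < y`. -/
def TnormArchimedean (T : ℝ → ℝ → ℝ) : Prop :=
  ∀ x ∈ Ioo (0:ℝ) 1, ∀ y ∈ Ioo (0:ℝ) 1, ∃ n : ℕ, Tpow T x n < y

/-- Strict monotonicity of a t-norm: `T x y < T x z` whenever `x > 0` and `y < z`. -/
def TnormStrictMono (T : ℝ → ℝ → ℝ) : Prop :=
  ∀ x ∈ Icc (0:ℝ) 1, 0 < x → ∀ y ∈ Icc (0:ℝ) 1, ∀ z ∈ Icc (0:ℝ) 1, y < z → T x y < T x z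

/-- Pseudo-inverse of a decreasing `G : [0,1] → [0,∞]`:
`G^(−1)(y) = sup {x ∈ [0,1] | G x > y}`. -/
noncomputable def pseudoInv (G : ℝ → ENNReal) (y : ENNReal) : ℝ :=
  sSup {x ∈ Icc (0:ℝ) 1 | y < G x}

/-- `G : [0,1] → [0,∞]` is an additive generator of the t-norm `T`. -/
structure IsAddGen (T : ℝ → ℝ → ℝ) (G : ℝ → ENNReal) : Prop where
  strictAnti : StrictAntiOn G (Icc (0:ℝ) 1)
  rightContinuousAtZero : ContinuousWithinAt G (Icc (0:ℝ) 1) 0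
  map_one : G 1 = 0
  sum_mem : ∀ x ∈ Icc (0:ℝ) 1, ∀ y ∈ Icc (0:ℝ) 1,
    G x + G y ∈ G '' Icc (0:ℝ) 1 ∪ Icc (G 0) ⊤
  eq_pseudoInv : ∀ x ∈ Icc (0:ℝ) 1, ∀ y ∈ Icc (0:ℝ) 1, T x y = pseudoInv G (G x + G y)

open Filter Topology

namespace IsTnorm

variable {T : ℝ → ℝ → ℝ}

lemma one_left (hT : IsTnorm T) {x : ℝ} (hx : x ∈ Icc (0:ℝ) 1) : T 1 x = x := by
  rw [hT.comm 1 (by simp) x hx, hT.one x hx]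

lemma mono_both (hT : IsTnorm T) {a b c d : ℝ} (ha : a ∈ Icc (0:ℝ) 1) (hb : b ∈ Icc (0:ℝ) 1)
    (hc : c ∈ Icc (0:ℝ) 1) (hd : d ∈ Icc (0:ℝ) 1) (hab : a ≤ b) (hcd : c ≤ d) :
    T a c ≤ T b d := by
  refine (hT.mono a ha c hc d hd hcd).trans ?_
  rw [hT.comm a ha d hd, hT.comm b hb d hd]
  exact hT.mono d hd a ha b hb hab

lemma le_left (hT : IsTnorm T) {x y : ℝ} (hx : x ∈ Icc (0:ℝ) 1) (hy : y ∈ Icc (0:ℝ) 1) :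
    T x y ≤ x := by
  simpa only [hT.one x hx] using hT.mono x hx y hy 1 (by simp) hy.2

lemma mul_mul_mul_comm (hT : IsTnorm T) {a b c d : ℝ} (ha : a ∈ Icc (0:ℝ) 1)
    (hb : b ∈ Icc (0:ℝ) 1) (hc : c ∈ Icc (0:ℝ) 1) (hd : d ∈ Icc (0:ℝ) 1) :
    T (T a b) (T c d) = T (T a c) (T b d) := by
  rw [hT.assoc a ha b hb _ (hT.maps_to c hc d hd), hT.assoc a ha c hc _ (hT.maps_to b hb d hd),
    ← hT.assoc b hb c hc d hd, ← hT.assoc c hc b hb d hd, hT.comm b hb c hc]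

lemma tpow_mem (hT : IsTnorm T) {u : ℝ} (hu : u ∈ Icc (0:ℝ) 1) (n : ℕ) :
    Tpow T u n ∈ Icc (0:ℝ) 1 := by
  induction n with
  | zero => simp [Tpow]
  | succ n ih => exact hT.maps_to _ ih _ hu

lemma tpow_add (hT : IsTnorm T) {u : ℝ} (hu : u ∈ Icc (0:ℝ) 1) (m n : ℕ) :
    Tpow T u (m + n) = T (Tpow T u m) (Tpow T u n) := by
  induction n with
  | zero => simp [Tpow, hT.one _ (hT.tpow_mem hu m)]
  | succ n ih =>
    change T (Tpow T u (m + n)) u = T _ (T _ u)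
    rw [ih, hT.assoc _ (hT.tpow_mem hu m) _ (hT.tpow_mem hu n) _ hu]

lemma tpow_mul (hT : IsTnorm T) {u : ℝ} (hu : u ∈ Icc (0:ℝ) 1) (m n : ℕ) :
    Tpow T u (m * n) = Tpow T (Tpow T u m) n := by
  induction n with
  | zero => rfl
  | succ n ih => rw [Nat.mul_succ, hT.tpow_add hu, ih]; rfl

lemma mul_tpow (hT : IsTnorm T) {u v : ℝ} (hu : u ∈ Icc (0:ℝ) 1) (hv : v ∈ Icc (0:ℝ) 1)
    (n : ℕ) : Tpow T (T u v) n = T (Tpow T u n) (Tpow T v n) := by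
  induction n with
  | zero => simp [Tpow, hT.one]
  | succ n ih =>
    change T (Tpow T (T u v) n) (T u v) = T (T _ u) (T _ v)
    rw [ih, hT.mul_mul_mul_comm (hT.tpow_mem hu n) (hT.tpow_mem hv n) hu hv]

lemma one_tpow (hT : IsTnorm T) (n : ℕ) : Tpow T 1 n = 1 := by
  induction n with
  | zero => rfl
  | succ n ih => simp [Tpow, ih, hT.one]

lemma tpow_antitone (hT : IsTnorm T) {u : ℝ} (hu : u ∈ Icc (0:ℝ) 1) : Antitone (Tpow T u) :=
  antitone_nat_of_succ_le fun n => hT.le_left (hT.tpow_mem hu n) hu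

lemma zero_tpow (hT : IsTnorm T) {n : ℕ} (hn : n ≠ 0) : Tpow T 0 n = 0 := by
  obtain ⟨n, rfl⟩ := Nat.exists_eq_succ_of_ne_zero hn
  have h0 : (0:ℝ) ∈ Icc (0:ℝ) 1 := by simp
  refine le_antisymm ?_ (hT.tpow_mem h0 _).1
  exact (hT.mono_both (hT.tpow_mem h0 n) (by simp) h0 h0 (hT.tpow_mem h0 n).2 le_rfl).trans
    (hT.one_left h0).le

lemma pos (hT : IsTnorm T) (hs : TnormStrictMono T) {x y : ℝ} (hx : x ∈ Icc (0:ℝ) 1)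
    (hy : y ∈ Icc (0:ℝ) 1) (hx0 : 0 < x) (hy0 : 0 < y) : 0 < T x y :=
  (hT.maps_to x hx 0 (by simp)).1.trans_lt (hs x hx hx0 0 (by simp) y hy hy0)

lemma tpow_pos (hT : IsTnorm T) (hs : TnormStrictMono T) {u : ℝ} (hu : u ∈ Icc (0:ℝ) 1)
    (hu0 : 0 < u) (n : ℕ) : 0 < Tpow T u n := by
  induction n with
  | zero => simp [Tpow]
  | succ n ih => exact hT.pos hs (hT.tpow_mem hu n) hu ih hu0

lemma tpow_monotoneOn (hT : IsTnorm T) (n : ℕ) :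
    MonotoneOn (fun u => Tpow T u n) (Icc (0:ℝ) 1) := by
  intro a ha b hb hab
  induction n with
  | zero => exact le_rfl
  | succ n ih => exact hT.mono_both (hT.tpow_mem ha n) (hT.tpow_mem hb n) ha hb ih hab

lemma tpow_strictMonoOn (hT : IsTnorm T) (hs : TnormStrictMono T) {n : ℕ} (hn : n ≠ 0) :
    StrictMonoOn (fun u => Tpow T u n) (Icc (0:ℝ) 1) := by
  obtain ⟨n, rfl⟩ := Nat.exists_eq_succ_of_ne_zero hn
  intro a ha b hb hab
  exact (hT.mono_both (hT.tpow_mem ha n) (hT.tpow_mem hb n) ha ha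
      (hT.tpow_monotoneOn n ha hb hab.le) le_rfl).trans_lt
    (hs _ (hT.tpow_mem hb n) (hT.tpow_pos hs hb (ha.1.trans_lt hab) n) a ha b hb hab)

lemma tpow_continuousOn (hT : IsTnorm T) (hc : ContinuousOn2 T) (n : ℕ) :
    ContinuousOn (fun u => Tpow T u n) (Icc (0:ℝ) 1) := by
  induction n with
  | zero => exact continuousOn_const
  | succ n ih =>
    exact ContinuousOn.comp (g := fun p : ℝ × ℝ => T p.1 p.2) (f := fun u => (Tpow T u n, u)) hc
      (ih.prodMk continuousOn_id) fun u hu => ⟨hT.tpow_mem hu n, hu⟩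

lemma troot_tpow (hT : IsTnorm T) (hs : TnormStrictMono T) {w : ℝ} (hw : w ∈ Icc (0:ℝ) 1)
    {n : ℕ} (hn : n ≠ 0) : Troot T (Tpow T w n) n = w := by
  have hset : {v ∈ Icc (0:ℝ) 1 | Tpow T v n < Tpow T w n} = Ico 0 w := by
    ext v
    constructor
    · rintro ⟨hv, hlt⟩
      exact ⟨hv.1, ((hT.tpow_strictMonoOn hs hn).lt_iff_lt hv hw).1 hlt⟩
    · rintro ⟨hv0, hvw⟩
      have hv : v ∈ Icc (0:ℝ) 1 := ⟨hv0, hvw.le.trans hw.2⟩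
      exact ⟨hv, hT.tpow_strictMonoOn hs hn hv hw hvw⟩
  rw [Troot, hset]
  rcases hw.1.eq_or_lt with rfl | h
  · simp
  · exact csSup_Ico h

lemma exists_tpow_eq (hT : IsTnorm T) (hc : ContinuousOn2 T) {u : ℝ} (hu : u ∈ Icc (0:ℝ) 1)
    {n : ℕ} (hn : n ≠ 0) : ∃ w ∈ Icc (0:ℝ) 1, Tpow T w n = u := by
  refine intermediate_value_Icc zero_le_one (hT.tpow_continuousOn hc n) ?_
  simpa only [hT.zero_tpow hn, hT.one_tpow n] using hu

lemma troot_mem (hT : IsTnorm T) (hc : ContinuousOn2 T) (hs : TnormStrictMono T) {u : ℝ}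
    (hu : u ∈ Icc (0:ℝ) 1) {n : ℕ} (hn : n ≠ 0) : Troot T u n ∈ Icc (0:ℝ) 1 := by
  obtain ⟨w, hw, rfl⟩ := hT.exists_tpow_eq hc hu hn
  rwa [hT.troot_tpow hs hw hn]

lemma tratPow_mem (hT : IsTnorm T) (hc : ContinuousOn2 T) (hs : TnormStrictMono T) {u : ℝ}
    (hu : u ∈ Icc (0:ℝ) 1) (r : ℚ) : TratPow T u r ∈ Icc (0:ℝ) 1 :=
  hT.tpow_mem (hT.troot_mem hc hs hu r.den_nz) _

lemma tratPow_mul (hT : IsTnorm T) (hc : ContinuousOn2 T) (hs : TnormStrictMono T) {u v : ℝ}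
    (hu : u ∈ Icc (0:ℝ) 1) (hv : v ∈ Icc (0:ℝ) 1) (r : ℚ) :
    TratPow T (T u v) r = T (TratPow T u r) (TratPow T v r) := by
  obtain ⟨a, ha, rfl⟩ := hT.exists_tpow_eq hc hu r.den_nz
  obtain ⟨b, hb, rfl⟩ := hT.exists_tpow_eq hc hv r.den_nz
  rw [← hT.mul_tpow ha hb]
  simp only [TratPow]
  rw [hT.troot_tpow hs (hT.maps_to a ha b hb) r.den_nz, hT.troot_tpow hs ha r.den_nz,
    hT.troot_tpow hs hb r.den_nz, hT.mul_tpow ha hb]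

lemma tratPow_antitoneOn (hT : IsTnorm T) (hc : ContinuousOn2 T) (hs : TnormStrictMono T)
    {u : ℝ} (hu : u ∈ Icc (0:ℝ) 1) : AntitoneOn (TratPow T u) {r | 0 ≤ r} := by
  intro r hr s hs0 hrs
  obtain ⟨w, hw, rfl⟩ := hT.exists_tpow_eq hc hu (mul_ne_zero r.den_nz s.den_nz)
  simp only [TratPow]
  rw [hT.tpow_mul hw r.den s.den, hT.troot_tpow hs (hT.tpow_mem hw _) s.den_nz,
    ← hT.tpow_mul hw r.den s.den, mul_comm r.den, hT.tpow_mul hw s.den r.den,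
    hT.troot_tpow hs (hT.tpow_mem hw _) r.den_nz, ← hT.tpow_mul hw, ← hT.tpow_mul hw]
  refine hT.tpow_antitone hw ?_
  have h := Rat.le_iff r s |>.1 hrs
  zify
  rw [Int.toNat_of_nonneg (Rat.num_nonneg.2 hr), Int.toNat_of_nonneg (Rat.num_nonneg.2 hs0)]
  linarith

lemma tendsto_tratPow (hT : IsTnorm T) (hc : ContinuousOn2 T) (hs : TnormStrictMono T)
    {u : ℝ} (hu : u ∈ Icc (0:ℝ) 1) (t : ℝ) :
    Tendsto (fun r : {r : ℚ | 0 ≤ r ∧ (r : ℝ) ≤ t} => TratPow T u r) atTop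
      (𝓝 (TrePow T u t)) := by
  rw [TrePow, sInf_image']
  refine tendsto_atTop_ciInf ?_ ⟨0, ?_⟩
  · exact fun r s hrs => hT.tratPow_antitoneOn hc hs hu r.2.1 s.2.1 hrs
  · rintro _ ⟨r, rfl⟩
    exact (hT.tratPow_mem hc hs hu r).1

end IsTnorm

/-- Every strict (continuous, strictly monotone) t-norm is power stable. -/
theorem strict_tnorm_power_stable (T : ℝ → ℝ → ℝ) (hT : IsTnorm T)
    (hTc : ContinuousOn2 T) (hstrict : TnormStrictMono T) :
    ∀ u ∈ Icc (0:ℝ) 1, ∀ v ∈ Icc (0:ℝ) 1, ∀ t : ℝ, 0 < t →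
      TrePow T (T u v) t = T (TrePow T u t) (TrePow T v t) := by
  intro u hu v hv t ht
  have : Nonempty {r : ℚ | 0 ≤ r ∧ (r : ℝ) ≤ t} := ⟨⟨0, le_rfl, by simpa using ht.le⟩⟩
  have hlu := hT.tendsto_tratPow hTc hstrict hu t
  have hlv := hT.tendsto_tratPow hTc hstrict hv t
  have hluv := hT.tendsto_tratPow hTc hstrict (hT.maps_to u hu v hv) t
  have hmu : TrePow T u t ∈ Icc (0:ℝ) 1 :=
    isClosed_Icc.mem_of_tendsto hlu (.of_forall fun r => hT.tratPow_mem hTc hstrict hu r)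
  have hmv : TrePow T v t ∈ Icc (0:ℝ) 1 :=
    isClosed_Icc.mem_of_tendsto hlv (.of_forall fun r => hT.tratPow_mem hTc hstrict hv r)
  refine tendsto_nhds_unique hluv ?_
  simp only [hT.tratPow_mul hTc hstrict hu hv]
  exact (hTc (TrePow T u t, TrePow T v t) ⟨hmu, hmv⟩).tendsto.comp
    (tendsto_nhdsWithin_iff.2 ⟨hlu.prodMk_nhds hlv, .of_forall fun r =>
      ⟨hT.tratPow_mem hTc hstrict hu r, hT.tratPow_mem hTc hstrict hv r⟩⟩)
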